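/- arXiv:1111.5811 — 4 statements merged into one kernel-verified Lean document; each statement's English description precedes it below -/
import Mathlib

section
/- Let p ≥ 2 be an integer and l ≥ 1. Every tuple x : Fin l → ℕ has a unique expression x = Σ_{j=0}^{m} p^j • a_j, where m ∈ ℕ, each a_j : Fin l → ℕ, for every j < m every coordinate of a_j lies in the interval [p − 1, 2p − 2], and the top digit a_m has at least one coordinate strictly less than p − 1. Uniqueness means: both the length m and the digits a_0, …, a_m are uniquely determined by x. -/
/-- `a 0, …, a m` are the digits of an expansion of `x` in base `p`: all digits but the top one
have coordinates in `[p - 1, 2p - 2]`, and the top one has a coordinate below `p - 1`. -/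
def IsSteinbergExpansion {ι : Type*} (p : ℕ) (x : ι → ℕ) (m : ℕ) (a : Fin (m + 1) → ι → ℕ) :
    Prop :=
  (∀ j : Fin (m + 1), (j : ℕ) < m → ∀ i, p - 1 ≤ a j i ∧ a j i ≤ 2 * p - 2) ∧
    (∃ i, a (Fin.last m) i < p - 1) ∧
    x = ∑ j : Fin (m + 1), p ^ (j : ℕ) • a j

namespace IsSteinbergExpansion

variable {ι : Type*} {p : ℕ}

theorem zero_iff {x : ι → ℕ} {a : Fin 1 → ι → ℕ} :
    IsSteinbergExpansion p x 0 a ↔ x = a 0 ∧ ∃ i, x i < p - 1 := by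
  have hsum : ∑ j : Fin (0 + 1), p ^ (j : ℕ) • a j = a 0 := by simp
  constructor
  · rintro ⟨-, h, hx⟩
    obtain rfl : x = a 0 := hx.trans hsum
    exact ⟨rfl, h⟩
  · rintro ⟨rfl, h⟩
    exact ⟨fun _ hj => absurd hj (Nat.not_lt_zero _), h, hsum.symm⟩

theorem succ_iff {x : ι → ℕ} {m : ℕ} {a : Fin (m + 2) → ι → ℕ} :
    IsSteinbergExpansion p x (m + 1) a ↔
      (∀ i, p - 1 ≤ a 0 i ∧ a 0 i ≤ 2 * p - 2) ∧
        ∃ y, x = a 0 + p • y ∧ IsSteinbergExpansion p y m (Fin.tail a) := by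
  have hsum : ∑ j : Fin (m + 2), p ^ (j : ℕ) • a j =
      a 0 + p • ∑ j : Fin (m + 1), p ^ (j : ℕ) • Fin.tail a j := by
    rw [Fin.sum_univ_succ, Finset.smul_sum]
    simp [Fin.tail, pow_succ', mul_smul]
  constructor
  · rintro ⟨h₁, h₂, h₃⟩
    refine ⟨h₁ 0 (Nat.succ_pos m), _, h₃.trans hsum, fun j hj => h₁ j.succ ?_, h₂, rfl⟩
    simpa using hj
  · rintro ⟨h₀, y, hx, h₁, h₂, rfl⟩
    refine ⟨fun j => ?_, h₂, hx.trans hsum.symm⟩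
    induction j using Fin.cases with
    | zero => exact fun _ => h₀
    | succ j => exact fun hj => h₁ j (by simpa using hj)

end IsSteinbergExpansion

theorem Nat.eq_add_mul_iff_of_mem_Icc {p x r y : ℕ} (hr : p - 1 ≤ r ∧ r ≤ 2 * p - 2) (hp : 0 < p) :
    x = r + p * y ↔
      p - 1 ≤ x ∧ r = p - 1 + (x - (p - 1)) % p ∧ y = (x - (p - 1)) / p := by
  obtain ⟨s, rfl⟩ := Nat.exists_eq_add_of_le hr.1
  have hs : s < p := by omega
  constructor
  · rintro rfl
    have h : p - 1 + s + p * y - (p - 1) = s + p * y := by omega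
    rw [h, Nat.add_mul_mod_self_left, Nat.mod_eq_of_lt hs, Nat.add_mul_div_left _ _ hp,
      Nat.div_eq_of_lt hs]
    omega
  · rintro ⟨hx, h₁, rfl⟩
    have := Nat.mod_add_div (x - (p - 1)) p
    omega

theorem existsUnique_isSteinbergExpansion {ι : Type*} [Nonempty ι] {p : ℕ} (hp : 2 ≤ p)
    (x : ι → ℕ) :
    ∃! d : Σ m : ℕ, Fin (m + 1) → ι → ℕ, IsSteinbergExpansion p x d.1 d.2 := by
  obtain ⟨i₀⟩ := ‹Nonempty ι›
  induction hn : x i₀ using Nat.strong_induction_on generalizing x with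
  | _ n ih =>
  subst hn
  by_cases hx : ∃ i, x i < p - 1
  · refine ⟨⟨0, fun _ => x⟩, IsSteinbergExpansion.zero_iff.2 ⟨rfl, hx⟩, ?_⟩
    rintro ⟨_ | m, a⟩ h
    · obtain ⟨rfl, -⟩ := IsSteinbergExpansion.zero_iff.1 h
      congr 1
      funext j
      rw [Fin.fin_one_eq_zero j]
    · obtain ⟨h₀, y, rfl, -⟩ := IsSteinbergExpansion.succ_iff.1 h
      obtain ⟨i, hi⟩ := hx
      exact absurd hi (not_lt.2 ((h₀ i).1.trans (Nat.le_add_right _ _)))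
  · push Not at hx
    set r : ι → ℕ := fun i => p - 1 + (x i - (p - 1)) % p with hr
    set y : ι → ℕ := fun i => (x i - (p - 1)) / p with hy
    have hr' : ∀ i, p - 1 ≤ r i ∧ r i ≤ 2 * p - 2 := fun i => by
      have := Nat.mod_lt (x i - (p - 1)) (by omega : p > 0)
      simp only [hr]
      omega
    have hxry : x = r + p • y := funext fun i =>
      (Nat.eq_add_mul_iff_of_mem_Icc (hr' i) (by omega)).2 ⟨hx i, rfl, rfl⟩
    have hlt : y i₀ < x i₀ := by
      have := Nat.div_le_self (x i₀ - (p - 1)) p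
      have := hx i₀
      simp only [hy]
      omega
    obtain ⟨⟨m, b⟩, hb, huniq⟩ := ih _ hlt y rfl
    refine ⟨⟨m + 1, Fin.cons r b⟩, IsSteinbergExpansion.succ_iff.2 ⟨hr', y, hxry, hb⟩, ?_⟩
    rintro ⟨_ | k, a⟩ h
    · obtain ⟨-, i, hi⟩ := IsSteinbergExpansion.zero_iff.1 h
      exact absurd hi (not_lt.2 (hx i))
    · obtain ⟨h₀, z, hz, hza⟩ := IsSteinbergExpansion.succ_iff.1 h
      have key i := (Nat.eq_add_mul_iff_of_mem_Icc (h₀ i) (by omega)).1 (congrFun hz i)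
      have har : a 0 = r := funext fun i => (key i).2.1
      have hzy : z = y := funext fun i => (key i).2.2
      subst hzy
      cases huniq ⟨k, Fin.tail a⟩ hza
      rw [← har, Fin.cons_self_tail]


/-- Coordinate form of the p-adic expansion of dominant weights: every
`x : Fin l → ℕ` has a unique expression `x = ∑ j, p ^ j • a j` where every
coordinate of every digit `a j` with `j < m` lies in `[p - 1, 2p - 2]`, and
the top digit `a m` has at least one coordinate strictly less than `p - 1`. -/
theorem padic_expansion (p l : ℕ) (hp : 2 ≤ p) (hl : 1 ≤ l) (x : Fin l → ℕ) :
    ∃! d : Σ m : ℕ, Fin (m + 1) → Fin l → ℕ,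
      (∀ j : Fin (d.1 + 1), (j : ℕ) < d.1 →
        ∀ i, p - 1 ≤ d.2 j i ∧ d.2 j i ≤ 2 * p - 2) ∧
      (∃ i, d.2 (Fin.last d.1) i < p - 1) ∧
      x = ∑ j : Fin (d.1 + 1), p ^ (j : ℕ) • d.2 j := by
  have : Nonempty (Fin l) := ⟨⟨0, hl⟩⟩
  exact existsUnique_isSteinbergExpansion hp x
end

section
/- For all natural numbers a, b, the following identity holds in the polynomial ring MvPolynomial (Fin 3) ℤ: (X₀ + X₁ + X₂) · a_{(a+b+2, b+1, 0)} = a_{(a+b+3, b+1, 0)} + a_{(a+b+2, b+2, 0)} + (X₀·X₁·X₂) · a_{(a+b+1, b, 0)}. -/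
open MvPolynomial

/-- The alternant `a_ν = ∑_σ sign σ · X_{σ 0}^{ν 0} · X_{σ 1}^{ν 1} · X_{σ 2}^{ν 2}`. -/
noncomputable def alt (ν : Fin 3 → ℕ) : MvPolynomial (Fin 3) ℤ :=
  ∑ σ : Equiv.Perm (Fin 3),
    (Equiv.Perm.sign σ : ℤ) • (X (σ 0) ^ ν 0 * X (σ 1) ^ ν 1 * X (σ 2) ^ ν 2)

/-- Multiplying an alternant by `e₁` raises each exponent in turn. -/
theorem sum_X_mul_alt (ν : Fin 3 → ℕ) :
    (∑ i, X i) * alt ν = ∑ i, alt (ν + Pi.single i 1) := by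
  simp only [alt]
  rw [Finset.mul_sum, Finset.sum_comm]
  refine Finset.sum_congr rfl fun σ _ => ?_
  rw [← Equiv.sum_comp σ, ← Finset.smul_sum, mul_smul_comm]
  congr 1
  simp [Fin.sum_univ_three]
  ring

/-- Multiplying an alternant by `e₃` raises all exponents. -/
theorem prod_X_mul_alt (ν : Fin 3 → ℕ) :
    (∏ i, X i) * alt ν = alt (ν + 1) := by
  simp only [alt]
  rw [Finset.mul_sum]
  refine Finset.sum_congr rfl fun σ _ => ?_
  rw [← Equiv.prod_comp σ, mul_smul_comm]
  congr 1
  simp only [Fin.prod_univ_three, Pi.add_apply, Pi.one_apply]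
  ring

/-- Alternant form of the character identity
`χ(E ⊗ Δ(aϖ₁ + bϖ₂)) = χ((a+1)ϖ₁ + bϖ₂) + χ(aϖ₁ + (b−1)ϖ₂) + χ((a−1)ϖ₁ + (b+1)ϖ₂)`. -/
theorem tensor_E_character (a b : ℕ) :
    (X 0 + X 1 + X 2) * alt ![a + b + 2, b + 1, 0] =
      alt ![a + b + 3, b + 1, 0] + alt ![a + b + 2, b + 2, 0] +
        (X 0 * X 1 * X 2) * alt ![a + b + 1, b, 0] := by
  have h₀ : ![a + b + 2, b + 1, 0] + Pi.single 0 1 = ![a + b + 3, b + 1, 0] := by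
    ext i; fin_cases i <;> simp
  have h₁ : ![a + b + 2, b + 1, 0] + Pi.single 1 1 = ![a + b + 2, b + 2, 0] := by
    ext i; fin_cases i <;> simp
  have h₂ : ![a + b + 2, b + 1, 0] + Pi.single 2 1 = ![a + b + 1, b, 0] + 1 := by
    ext i; fin_cases i <;> simp
  rw [← Fin.sum_univ_three, ← Fin.prod_univ_three, sum_X_mul_alt, prod_X_mul_alt,
    Fin.sum_univ_three, h₀, h₁, h₂]
end

section
/- For all natural numbers a, b, the following identity holds in the polynomial ring MvPolynomial (Fin 3) ℤ: (X₀·X₁ + X₀·X₂ + X₁·X₂) · a_{(a+b+2, b+1, 0)} = a_{(a+b+3, b+2, 0)} + (X₀·X₁·X₂) · ( a_{(a+b+2, b, 0)} + a_{(a+b+1, b+1, 0)} ). -/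
open MvPolynomial

/-- The second elementary symmetric polynomial in three variables is invariant under permutations
of the variables. -/
theorem esymm_two_perm {R : Type*} [CommSemiring R] (f : Fin 3 → R) (σ : Equiv.Perm (Fin 3)) :
    f (σ 0) * f (σ 1) + f (σ 0) * f (σ 2) + f (σ 1) * f (σ 2) =
      f 0 * f 1 + f 0 * f 2 + f 1 * f 2 := by
  have h01 : σ 0 ≠ σ 1 := σ.injective.ne (by decide)
  have h02 : σ 0 ≠ σ 2 := σ.injective.ne (by decide)
  have h12 : σ 1 ≠ σ 2 := σ.injective.ne (by decide)
  generalize σ 0 = i at *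
  generalize σ 1 = j at *
  generalize σ 2 = k at *
  fin_cases i <;> fin_cases j <;> try exact absurd rfl h01
  all_goals
    fin_cases k <;> first | exact absurd rfl h02 | exact absurd rfl h12 | (dsimp <;> ring)

/-- The third elementary symmetric polynomial in three variables is invariant under permutations
of the variables. -/
theorem esymm_three_perm {R : Type*} [CommMonoid R] (f : Fin 3 → R) (σ : Equiv.Perm (Fin 3)) :
    f (σ 0) * f (σ 1) * f (σ 2) = f 0 * f 1 * f 2 := by
  simpa only [Fin.prod_univ_three] using Equiv.prod_comp σ f

/-- Alternant form of the character identity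
`χ(E* ⊗ Δ(aϖ₁ + bϖ₂)) = χ(aϖ₁ + (b+1)ϖ₂) + χ((a+1)ϖ₁ + (b−1)ϖ₂) + χ((a−1)ϖ₁ + bϖ₂)`. -/
theorem tensor_Estar_character (a b : ℕ) :
    (X 0 * X 1 + X 0 * X 2 + X 1 * X 2) * alt ![a + b + 2, b + 1, 0] =
      alt ![a + b + 3, b + 2, 0] +
        (X 0 * X 1 * X 2) * (alt ![a + b + 2, b, 0] + alt ![a + b + 1, b + 1, 0]) := by
  simp only [alt, mul_add, Finset.mul_sum, ← Finset.sum_add_distrib]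
  refine Finset.sum_congr rfl fun σ _ => ?_
  rw [← esymm_two_perm X σ, ← esymm_three_perm X σ]
  simp only [zsmul_eq_mul, Matrix.cons_val]
  ring
end

section
/- For all natural numbers m, n with n ≤ m, the following identity holds in the polynomial ring MvPolynomial (Fin 3) ℤ: a_{(m+2, 1, 0)} · a_{(n+2, 1, 0)} = a_{(2, 1, 0)} · ( Σ_{i=0}^{n} a_{(m+n−i+2, i+1, 0)} ). -/
open MvPolynomial

theorem alt_eq_det (ν : Fin 3 → ℕ) :
    alt ν = (Matrix.of fun i j : Fin 3 => (X i ^ ν j : MvPolynomial (Fin 3) ℤ)).det := by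
  simp [alt, Matrix.det_apply, Fin.prod_univ_three, Units.smul_def]

/-- The two-row Jacobi–Trudi identity `h_m h_{n+1} - h_{m+1} h_n = s_{(m, n+1)}` in terms of
alternants. -/
theorem alt_mul_alt_succ (m n : ℕ) :
    alt ![m + 2, 1, 0] * alt ![n + 1 + 2, 1, 0] =
      alt ![m + 1 + 2, 1, 0] * alt ![n + 2, 1, 0]
        + alt ![2, 1, 0] * alt ![m + 2, n + 1 + 1, 0] := by
  simp only [alt_eq_det, Matrix.det_fin_three, Matrix.of_apply, Matrix.cons_val]
  ring

/-- Alternant form of the Littlewood–Richardson computation: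
`χ(mϖ₁) · χ(nϖ₁) = ∑_{i=0}^{n} χ((m+n−2i)ϖ₁ + iϖ₂)` for `n ≤ m`. -/
theorem one_row_LR (m n : ℕ) (hnm : n ≤ m) :
    alt ![m + 2, 1, 0] * alt ![n + 2, 1, 0] =
      alt ![2, 1, 0] * ∑ i ∈ Finset.range (n + 1), alt ![m + n - i + 2, i + 1, 0] := by
  clear hnm
  induction n generalizing m with
  | zero => simp [mul_comm]
  | succ n ih =>
    rw [Finset.sum_range_succ, mul_add, alt_mul_alt_succ, ih (m + 1), Nat.add_sub_cancel,
      Nat.add_right_comm m 1 n, Nat.add_assoc m n 1]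
end
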